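/- Every atypical anti-dominant symbol is of the form f_{k,n}: if (d, x, y, z) ∈ 𝔖ymb satisfies y ≤ x ≤ 0 and d ∈ {x, y, −z}, then there exist k, n ∈ ℕ with (d, x, y, z) = f_{k,n}. -/

import Mathlib

noncomputable section

/-- The weight space of the exceptional Lie superalgebra `G(3)`. -/
abbrev V : Type := ℚ × ℚ × ℚ

def δ : V := (1, 0, 0)
def ε₁ : V := (0, 1, 0)
def ε₂ : V := (0, 0, 1)
def ε₃ : V := -ε₁ - ε₂

/-- The symmetric bilinear form on `V` determined by `B(δ,δ) = -2`, `B(δ,εᵢ) = 0`,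
`B(εᵢ,εᵢ) = 2` and `B(εᵢ,εⱼ) = -1` for `i ≠ j` (with `ε₃ = -ε₁-ε₂`). -/
def B (u v : V) : ℚ :=
  -2 * u.1 * v.1 + 2 * u.2.1 * v.2.1 + 2 * u.2.2 * v.2.2 - u.2.1 * v.2.2 - u.2.2 * v.2.1

/-- `s₀ : δ ↦ -δ, ε₁ ↦ ε₁, ε₂ ↦ ε₂`. -/
def s₀ : V ≃ₗ[ℚ] V where
  toFun v := (-v.1, v.2.1, v.2.2)
  invFun v := (-v.1, v.2.1, v.2.2)
  map_add' a b := by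
    simp only [Prod.ext_iff, Prod.fst_add, Prod.snd_add]
    refine ⟨by ring, trivial, trivial⟩
  map_smul' c a := by
    simp only [Prod.ext_iff, Prod.smul_fst, Prod.smul_snd, smul_eq_mul, RingHom.id_apply]
    refine ⟨by ring, trivial, trivial⟩
  left_inv v := by simp
  right_inv v := by simp

/-- `s₁ : δ ↦ δ, ε₁ ↦ ε₂, ε₂ ↦ ε₁`. -/
def s₁ : V ≃ₗ[ℚ] V where
  toFun v := (v.1, v.2.2, v.2.1)
  invFun v := (v.1, v.2.2, v.2.1)
  map_add' a b := by
    simp only [Prod.ext_iff, Prod.fst_add, Prod.snd_add]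
    refine ⟨trivial, trivial, trivial⟩
  map_smul' c a := by
    simp only [Prod.ext_iff, Prod.smul_fst, Prod.smul_snd, smul_eq_mul, RingHom.id_apply]
    refine ⟨trivial, trivial, trivial⟩
  left_inv v := by simp
  right_inv v := by simp

/-- `s₂ : δ ↦ δ, ε₁ ↦ -ε₁, ε₂ ↦ ε₁ + ε₂`. -/
def s₂ : V ≃ₗ[ℚ] V where
  toFun v := (v.1, v.2.2 - v.2.1, v.2.2)
  invFun v := (v.1, v.2.2 - v.2.1, v.2.2)
  map_add' a b := by
    simp only [Prod.ext_iff, Prod.fst_add, Prod.snd_add]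
    refine ⟨trivial, by ring, trivial⟩
  map_smul' c a := by
    simp only [Prod.ext_iff, Prod.smul_fst, Prod.smul_snd, smul_eq_mul, RingHom.id_apply]
    refine ⟨trivial, by ring, trivial⟩
  left_inv v := by
    obtain ⟨a, b, c⟩ := v
    simp only [Prod.mk.injEq]
    norm_num
  right_inv v := by
    obtain ⟨a, b, c⟩ := v
    simp only [Prod.mk.injEq]
    norm_num

/-- The integral Weyl group `W = ⟨s₀, s₁, s₂⟩` of `G(3)`. -/
def W : Subgroup (V ≃ₗ[ℚ] V) := Subgroup.closure {s₀, s₁, s₂}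

/-- The set of positive even roots of `G(3)`. -/
def Φ₀ : Set V := {(2:ℚ) • δ, ε₁, ε₂, -ε₃, ε₂ - ε₁, ε₁ - ε₃, ε₂ - ε₃}

/-- The positive even roots, as a finite set. -/
def Φ₀F : Finset V := {(2:ℚ) • δ, ε₁, ε₂, -ε₃, ε₂ - ε₁, ε₁ - ε₃, ε₂ - ε₃}

/-- The positive odd roots, as a finite set. -/
def Φ₁F : Finset V := {δ, δ + ε₁, δ - ε₁, δ + ε₂, δ - ε₂, δ + ε₃, δ - ε₃}

/-- The isotropic positive odd roots of `G(3)`. -/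
def oddIso : Set V := {δ + ε₁, δ - ε₁, δ + ε₂, δ - ε₂, δ + ε₃, δ - ε₃}

/-- The `ρ`-shifted integral weight lattice `X + ρ`. -/
def Xρ : Set V :=
  {v : V | ∃ (m c₁ c₂ : ℤ), v = ((m : ℚ) + 1/2) • δ + (c₁ : ℚ) • ε₁ + (c₂ : ℚ) • ε₂}

/-- The symbol `[d | x, y, z]` of a weight `λ`. -/
def symb (v : V) : ℚ × ℚ × ℚ × ℚ := (-(B v δ)/2, B v ε₁/2, B v ε₂/2, B v ε₃/2)

/-- The set of symbols `𝔖ymb`. -/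
def Symb : Set (ℚ × ℚ × ℚ × ℚ) :=
  {s | (∃ m : ℤ, s.1 = (m : ℚ) + 1/2) ∧ (∃ m : ℤ, 2 * s.2.1 = (m : ℚ)) ∧
       (∃ m : ℤ, 2 * s.2.2.1 = (m : ℚ)) ∧ s.2.2.2 = -s.2.1 - s.2.2.1 ∧
       (∃ m : ℤ, 2 * (s.2.2.1 - s.2.1) / 3 = (m : ℚ))}

/-- The fundamental weight `ω₁` of `G₂`. -/
def ω₁ : V := ε₁ + (2:ℚ) • ε₂

/-- The fundamental weight `ω₂` of `G₂`. -/
def ω₂ : V := ε₁ + ε₂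

/-- The inverse of the symbol map. -/
def Ψinv (s : ℚ × ℚ × ℚ × ℚ) : V :=
  s.1 • δ + (2 * (s.2.2.1 - s.2.1) / 3) • ω₁ + (2 * s.2.1) • ω₂

/-- The atypical anti-dominant weights `λ_{k,n}`. -/
def lam (k n : ℕ) : V :=
  if n < k then
    (-((2*(n:ℚ)+1)/2)) • δ - ((n:ℚ)+(k:ℚ)+1) • ε₁ - (2*(k:ℚ)+1) • ε₂
  else if n = k then
    (-((2*(k:ℚ)+1)/2)) • δ - (2*(k:ℚ)+1) • ε₁ - (2*(k:ℚ)+1) • ε₂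
  else if n ≤ 3*k then
    (-((2*(n:ℚ)+1)/2)) • δ - (2*(k:ℚ)+1) • ε₁ - ((n:ℚ)+(k:ℚ)+1) • ε₂
  else if n = 3*k+1 then
    (-((6*(k:ℚ)+3)/2)) • δ - (2*(k:ℚ)+1) • ε₁ - (4*(k:ℚ)+2) • ε₂
  else
    (-((2*(n:ℚ)+1)/2)) • δ - ((n:ℚ)-(k:ℚ)) • ε₁ - ((n:ℚ)+(k:ℚ)+1) • ε₂

/-- The atypical anti-dominant symbols `f_{k,n}`. -/
def fsym (k n : ℕ) : ℚ × ℚ × ℚ × ℚ :=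
  if n < k then
    (-(2*(n:ℚ)+1)/2, -(2*(n:ℚ)+1)/2, ((n:ℚ)-3*(k:ℚ)-1)/2, (3*(k:ℚ)+(n:ℚ)+2)/2)
  else if n = k then
    (-(2*(k:ℚ)+1)/2, -(2*(k:ℚ)+1)/2, -(2*(k:ℚ)+1)/2, 2*(k:ℚ)+1)
  else if n ≤ 3*k then
    (-(2*(n:ℚ)+1)/2, ((n:ℚ)-3*(k:ℚ)-1)/2, -(2*(n:ℚ)+1)/2, (3*(k:ℚ)+(n:ℚ)+2)/2)
  else if n = 3*k+1 then
    (-(3*(2*(k:ℚ)+1))/2, 0, -(3*(2*(k:ℚ)+1))/2, 3*(2*(k:ℚ)+1)/2)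
  else
    (-(2*(n:ℚ)+1)/2, -((n:ℚ)-3*(k:ℚ)-1)/2, -(3*(k:ℚ)+(n:ℚ)+2)/2, (2*(n:ℚ)+1)/2)

/-- The Weyl vector `ρ` of `G(3)`. -/
def ρ : V := (-(5/2) : ℚ) • δ + (2:ℚ) • ε₁ + (3:ℚ) • ε₂

/-- Every atypical anti-dominant symbol is of the form `f_{k,n}`: if
`(d, x, y, z) ∈ 𝔖ymb` satisfies `y ≤ x ≤ 0` and `d ∈ {x, y, −z}`, then
`(d, x, y, z) = f_{k,n}` for some `k, n ∈ ℕ`. -/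
theorem atypical_antidominant_symbol_eq_fsym (s : ℚ × ℚ × ℚ × ℚ) (hs : s ∈ Symb)
    (h1 : s.2.2.1 ≤ s.2.1) (h2 : s.2.1 ≤ 0)
    (h3 : s.1 = s.2.1 ∨ s.1 = s.2.2.1 ∨ s.1 = -s.2.2.2) :
    ∃ k n : ℕ, s = fsym k n := by
  obtain ⟨d, x, y, z⟩ := s
  obtain ⟨⟨m, hm⟩, ⟨a, ha⟩, ⟨b, hb⟩, hz, ⟨c, hc⟩⟩ := hs
  dsimp only at *
  -- In terms of integers: `d = m + 1/2`, `2x = a`, `2y = b = a + 3c`.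
  have hbc : b = a + 3 * c := by
    have : (b : ℚ) = a + 3 * c := by linarith
    exact_mod_cast this
  have hc0 : c ≤ 0 := by
    have : (c : ℚ) ≤ 0 := by linarith
    exact_mod_cast this
  have ha0 : a ≤ 0 := by
    have : (a : ℚ) ≤ 0 := by linarith
    exact_mod_cast this
  have hx : x = a / 2 := by linarith
  have hy : y = b / 2 := by linarith
  rcases h3 with h | h | h
  · have hma : 2 * m + 1 = a := by
      have : 2 * (m : ℚ) + 1 = a := by linarith
      exact_mod_cast this
    obtain ⟨n, hn⟩ : ∃ n : ℕ, m = -n - 1 := ⟨(-m - 1).toNat, by omega⟩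
    obtain ⟨j, hj⟩ : ∃ j : ℕ, c = -j := ⟨(-c).toNat, by omega⟩
    refine ⟨n + j, n, ?_⟩
    subst hbc hma hn hj hx hy hz hm
    rcases Nat.eq_zero_or_pos j with rfl | hj0
    · simp only [fsym, add_zero, lt_irrefl, if_false, if_true, Prod.mk.injEq]
      push_cast
      refine ⟨?_, ?_, ?_, ?_⟩ <;> ring
    · simp only [fsym, if_pos (show n < n + j by omega), Prod.mk.injEq]
      push_cast
      refine ⟨?_, ?_, ?_, ?_⟩ <;> ring
  · have hmb : 2 * m + 1 = b := by
      have : 2 * (m : ℚ) + 1 = b := by linarith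
      exact_mod_cast this
    obtain ⟨j, hj⟩ : ∃ j : ℕ, c = -j := ⟨(-c).toNat, by omega⟩
    obtain ⟨k, hk⟩ : ∃ k : ℕ, m = -(k + j) - 1 := ⟨(-m - 1 - j).toNat, by omega⟩
    have hae : a = j - 2 * k - 1 := by omega
    have hjk : j ≤ 2 * k + 1 := by omega
    refine ⟨k, k + j, ?_⟩
    subst hmb hk hj hx hy hz hm hae
    rcases Nat.eq_zero_or_pos j with rfl | hj0
    · simp only [fsym, add_zero, lt_irrefl, if_false, if_true, Prod.mk.injEq]
      push_cast
      refine ⟨?_, ?_, ?_, ?_⟩ <;> ring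
    rcases hjk.eq_or_lt with rfl | hlt
    · simp only [fsym, if_neg (show ¬ k + (2 * k + 1) < k by omega),
        if_neg (show ¬ k + (2 * k + 1) = k by omega),
        if_neg (show ¬ k + (2 * k + 1) ≤ 3 * k by omega),
        if_pos (show k + (2 * k + 1) = 3 * k + 1 by omega), Prod.mk.injEq]
      push_cast
      refine ⟨?_, ?_, ?_, ?_⟩ <;> ring
    · simp only [fsym, if_neg (show ¬ k + j < k by omega), if_neg (show ¬ k + j = k by omega),
        if_pos (show k + j ≤ 3 * k by omega), Prod.mk.injEq]
      push_cast
      refine ⟨?_, ?_, ?_, ?_⟩ <;> ring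
  · have hmab : 2 * m + 1 = a + b := by
      have : 2 * (m : ℚ) + 1 = a + b := by linarith
      exact_mod_cast this
    -- The parity of `a + b = 2a + 3c` forces `c` to be odd.
    obtain ⟨k, hk⟩ : ∃ k : ℕ, c = -(2 * k + 1) := ⟨((-c - 1) / 2).toNat, by omega⟩
    obtain ⟨i, hi⟩ : ∃ i : ℕ, a = -i := ⟨(-a).toNat, by omega⟩
    have hme : m = -(3 * k + 1 + i) - 1 := by omega
    refine ⟨k, 3 * k + 1 + i, ?_⟩
    subst hbc hk hi hx hy hz hm hme
    rcases Nat.eq_zero_or_pos i with rfl | hi0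
    · simp only [fsym, add_zero, if_neg (show ¬ 3 * k + 1 < k by omega),
        if_neg (show ¬ 3 * k + 1 = k by omega),
        if_neg (show ¬ 3 * k + 1 ≤ 3 * k by omega), if_true, Prod.mk.injEq]
      push_cast
      refine ⟨?_, ?_, ?_, ?_⟩ <;> ring
    · simp only [fsym, if_neg (show ¬ 3 * k + 1 + i < k by omega),
        if_neg (show ¬ 3 * k + 1 + i = k by omega),
        if_neg (show ¬ 3 * k + 1 + i ≤ 3 * k by omega),
        if_neg (show ¬ 3 * k + 1 + i = 3 * k + 1 by omega), Prod.mk.injEq]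
      push_cast
      refine ⟨?_, ?_, ?_, ?_⟩ <;> ring
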